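/- arXiv:0802.2325 — 12 statements merged into one kernel-verified Lean document; each statement's English description precedes it below -/
import Mathlib

section
/- Let ε₁, ε₂ ∈ {−1, 1}, let h be the symmetric bilinear form on ℝ² given by h(x, y) = ε₁x₁y₁ + ε₂x₂y₂, and let T : ℝ² × ℝ² → ℝ² be a bilinear map. Then the identity h(Y,Z)·T(W,X) − h(X,Z)·T(W,Y) = h(Y,W)·T(Z,X) − h(X,W)·T(Z,Y) holds for all X, Y, Z, W ∈ ℝ² if and only if ε₁·T(e₁,e₁) + ε₂·T(e₂,e₂) = 0, where (e₁, e₂) is the standard basis of ℝ². -/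
/-- For a bilinear map `T` on `ℝ²` and the (pseudo-)metric
`h(x,y) = ε₁ x₁ y₁ + ε₂ x₂ y₂` with `ε₁, ε₂ ∈ {−1,1}`, the identity
`h(Y,Z)·T(W,X) − h(X,Z)·T(W,Y) = h(Y,W)·T(Z,X) − h(X,W)·T(Z,Y)` holds for all
`X, Y, Z, W` iff `ε₁·T(e₁,e₁) + ε₂·T(e₂,e₂) = 0`. -/
theorem stmt0 (ε₁ ε₂ : ℝ) (hε₁ : ε₁ = 1 ∨ ε₁ = -1) (hε₂ : ε₂ = 1 ∨ ε₂ = -1)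
    (T : (ℝ × ℝ) →ₗ[ℝ] (ℝ × ℝ) →ₗ[ℝ] (ℝ × ℝ)) :
    (∀ X Y Z W : ℝ × ℝ,
        (ε₁ * Y.1 * Z.1 + ε₂ * Y.2 * Z.2) • T W X
          - (ε₁ * X.1 * Z.1 + ε₂ * X.2 * Z.2) • T W Y
        = (ε₁ * Y.1 * W.1 + ε₂ * Y.2 * W.2) • T Z X
          - (ε₁ * X.1 * W.1 + ε₂ * X.2 * W.2) • T Z Y)
      ↔ ε₁ • T (1, 0) (1, 0) + ε₂ • T (0, 1) (0, 1) = 0 := by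
  have sq₁ : ε₁ * ε₁ = 1 := by rcases hε₁ with rfl | rfl <;> norm_num
  have sq₂ : ε₂ * ε₂ = 1 := by rcases hε₂ with rfl | rfl <;> norm_num
  have swap : ε₂ • T (1, 0) (1, 0) + ε₁ • T (0, 1) (0, 1)
      = (ε₁ * ε₂) • (ε₁ • T (1, 0) (1, 0) + ε₂ • T (0, 1) (0, 1)) := by
    rw [smul_add, smul_smul, smul_smul, mul_right_comm, sq₁, one_mul, mul_assoc, sq₂, mul_one]
  have hne : ε₁ * ε₂ ≠ 0 :=
    mul_ne_zero (left_ne_zero_of_mul_eq_one sq₁) (left_ne_zero_of_mul_eq_one sq₂)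
  rw [← smul_eq_zero_iff_right hne, ← swap]
  constructor
  · intro H
    have key := H (1, 0) (0, 1) (1, 0) (0, 1)
    simp only [mul_zero, mul_one, add_zero, zero_add, zero_smul, zero_sub, sub_zero] at key
    rw [← key, neg_add_cancel]
  · intro H X Y Z W
    have expand (U V : ℝ × ℝ) : T U V
        = (U.1 * V.1) • T (1, 0) (1, 0) + (U.1 * V.2) • T (1, 0) (0, 1)
          + (U.2 * V.1) • T (0, 1) (1, 0) + (U.2 * V.2) • T (0, 1) (0, 1) := by
      have basis (P : ℝ × ℝ) : P = P.1 • ((1, 0) : ℝ × ℝ) + P.2 • ((0, 1) : ℝ × ℝ) := by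
        ext <;> simp
      conv_lhs => rw [basis U, basis V]
      simp only [map_add, map_smul, LinearMap.add_apply, LinearMap.smul_apply]
      module
    rw [expand W X, expand W Y, expand Z X, expand Z Y]
    linear_combination (norm := module)
      (-((X.1 * Y.2 - X.2 * Y.1) * (Z.1 * W.2 - Z.2 * W.1))) • H
end

section
/- Let ε, η ∈ {−1, 1}, let τ ∈ ℝ, let Ω ⊆ ℝ² be open, and let λ : Ω → ℝ be a smooth function with λ(x) ≠ 0 and λ(x)² ≠ τ for all x ∈ Ω. Set μ := τ/λ, and write Δ₀f := ε∂₁²f + η∂₂²f and |∇f|² := ε(∂₁f)² + η(∂₂f)². Then the system of equations Δ₀μ + (2/(λ−μ))|∇μ|² = μ, Δ₀λ − (2/(λ−μ))|∇λ|² = −λ, ∂₁λ·∂₂μ = ∂₁μ·∂₂λ holds on Ω if and only if the single equation Δ₀λ + (2λ/(τ−λ²))(ε(∂₁λ)² + η(∂₂λ)²) = −λ holds on Ω. -/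
/-- First partial derivative of a function on `ℝ²`. -/
noncomputable def pd1 (f : ℝ × ℝ → ℝ) : ℝ × ℝ → ℝ := fun x => fderiv ℝ f x (1, 0)

/-- Second partial derivative of a function on `ℝ²`. -/
noncomputable def pd2 (f : ℝ × ℝ → ℝ) : ℝ × ℝ → ℝ := fun x => fderiv ℝ f x (0, 1)

/-- The operator `Δ₀ f = ε ∂₁²f + η ∂₂²f`. -/
noncomputable def lap0 (ε η : ℝ) (f : ℝ × ℝ → ℝ) : ℝ × ℝ → ℝ :=
  fun x => ε * pd1 (pd1 f) x + η * pd2 (pd2 f) x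

/-- `|∇f|² = ε (∂₁f)² + η (∂₂f)²`. -/
noncomputable def gradSq (ε η : ℝ) (f : ℝ × ℝ → ℝ) : ℝ × ℝ → ℝ :=
  fun x => ε * (pd1 f x) ^ 2 + η * (pd2 f x) ^ 2

/-- Directional derivative of a constant divided by a function. -/
theorem fderiv_const_div_apply {f : ℝ × ℝ → ℝ} {x : ℝ × ℝ} (τ : ℝ) (v : ℝ × ℝ)
    (hf : DifferentiableAt ℝ f x) (hx : f x ≠ 0) :
    fderiv ℝ (fun y => τ / f y) x v = -τ * fderiv ℝ f x v / f x ^ 2 := by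
  have h := ((hasDerivAt_inv hx).comp_hasFDerivAt x hf.hasFDerivAt).const_mul τ
  have h' : HasFDerivAt (fun y => τ / f y) (τ • (-(f x ^ 2)⁻¹) • fderiv ℝ f x) x := by
    simpa only [div_eq_mul_inv, Function.comp_def] using h
  rw [h'.fderiv]
  simp only [smul_apply, smul_eq_mul]
  ring

/-- Second directional derivative of a constant divided by a function. -/
theorem fderiv_fderiv_const_div_apply {f : ℝ × ℝ → ℝ} {s : Set (ℝ × ℝ)} (τ : ℝ) (v : ℝ × ℝ)
    (hs : IsOpen s) (hf : ContDiffOn ℝ 2 f s) (hne : ∀ x ∈ s, f x ≠ 0)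
    {x : ℝ × ℝ} (hx : x ∈ s) :
    fderiv ℝ (fun y => fderiv ℝ (fun z => τ / f z) y v) x v =
      -τ * fderiv ℝ (fun y => fderiv ℝ f y v) x v / f x ^ 2 +
        2 * τ * fderiv ℝ f x v ^ 2 / f x ^ 3 := by
  have hd : ∀ y ∈ s, DifferentiableAt ℝ f y := fun y hy =>
    (hf.contDiffAt (hs.mem_nhds hy)).differentiableAt (by norm_num)
  have heq : (fun y => fderiv ℝ (fun z => τ / f z) y v) =ᶠ[nhds x]
      fun y => fderiv ℝ f y v * (-τ / f y ^ 2) := by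
    filter_upwards [hs.mem_nhds hx] with y hy
    rw [fderiv_const_div_apply τ v (hd y hy) (hne y hy)]
    ring
  have hdf : DifferentiableAt ℝ (fun y => fderiv ℝ f y v) x :=
    (((hf.contDiffAt (hs.mem_nhds hx)).fderiv_right (m := 1) (by norm_num)).differentiableAt
      (by norm_num)).clm_apply (differentiableAt_const v)
  have hx0 := hne x hx
  have hsq0 : f x ^ 2 ≠ 0 := pow_ne_zero 2 hx0
  have hdiv : DifferentiableAt ℝ (fun y => -τ / f y ^ 2) x := by
    have hpow : DifferentiableAt ℝ (fun y => f y ^ 2) x := (hd x hx).fun_pow 2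
    fun_prop (disch := exact hsq0)
  rw [heq.fderiv_eq, fderiv_fun_mul hdf hdiv]
  simp only [add_apply, smul_apply, smul_eq_mul]
  rw [fderiv_const_div_apply (-τ) v ((hd x hx).fun_pow 2) hsq0, fderiv_fun_pow 2 (hd x hx)]
  simp only [smul_apply, smul_eq_mul, nsmul_eq_mul]
  field_simp
  push_cast
  ring

/-- With `μ = τ/λ`, the Gauss system (G) holds on `Ω` iff the single
second-order equation (2.21) holds on `Ω`. -/
theorem stmt1 (ε η τ : ℝ) (hε : ε = 1 ∨ ε = -1) (hη : η = 1 ∨ η = -1)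
    (Ω : Set (ℝ × ℝ)) (hΩ : IsOpen Ω)
    (lam : ℝ × ℝ → ℝ) (hlam : ContDiffOn ℝ (⊤ : ℕ∞) lam Ω)
    (hne : ∀ x ∈ Ω, lam x ≠ 0) (hneτ : ∀ x ∈ Ω, lam x ^ 2 ≠ τ)
    (μ : ℝ × ℝ → ℝ) (hμ : μ = fun x => τ / lam x) :
    ((∀ x ∈ Ω, lap0 ε η μ x + (2 / (lam x - μ x)) * gradSq ε η μ x = μ x) ∧
     (∀ x ∈ Ω, lap0 ε η lam x - (2 / (lam x - μ x)) * gradSq ε η lam x = -lam x) ∧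
     (∀ x ∈ Ω, pd1 lam x * pd2 μ x = pd1 μ x * pd2 lam x))
    ↔ (∀ x ∈ Ω,
        lap0 ε η lam x + (2 * lam x / (τ - lam x ^ 2)) *
          (ε * (pd1 lam x) ^ 2 + η * (pd2 lam x) ^ 2) = -lam x) := by
  subst hμ
  have hf : ContDiffOn ℝ 2 lam Ω := hlam.of_le (WithTop.coe_le_coe.mpr le_top)
  have hgrad : ∀ x ∈ Ω, ∀ v, fderiv ℝ (fun y => τ / lam y) x v =
      -τ * fderiv ℝ lam x v / lam x ^ 2 := fun x hx v =>
    fderiv_const_div_apply τ v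
      ((hf.contDiffAt (hΩ.mem_nhds hx)).differentiableAt (by norm_num)) (hne x hx)
  have hcoef : ∀ x ∈ Ω, 2 / (lam x - τ / lam x) = -(2 * lam x / (τ - lam x ^ 2)) := by
    intro x hx
    have h0 := hne x hx
    have h1 : lam x ^ 2 - τ ≠ 0 := sub_ne_zero.mpr (hneτ x hx)
    have h2 : τ - lam x ^ 2 ≠ 0 := sub_ne_zero.mpr (hneτ x hx).symm
    have h3 : lam x - τ / lam x = (lam x ^ 2 - τ) / lam x := by field_simp
    rw [h3]
    field_simp
    ring
  constructor
  · rintro ⟨-, h, -⟩ x hx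
    have := h x hx
    rw [hcoef x hx] at this
    simp only [gradSq] at this
    linarith
  · intro h
    refine ⟨fun x hx => ?_, fun x hx => ?_, fun x hx => ?_⟩
    · have h0 := hne x hx
      have h2 : τ - lam x ^ 2 ≠ 0 := sub_ne_zero.mpr (hneτ x hx).symm
      have hL := h x hx
      rw [hcoef x hx]
      unfold lap0 pd1 pd2 at hL
      unfold lap0 gradSq pd1 pd2
      rw [fderiv_fderiv_const_div_apply τ _ hΩ hf hne hx,
        fderiv_fderiv_const_div_apply τ _ hΩ hf hne hx, hgrad x hx, hgrad x hx]
      generalize fderiv ℝ (fun y => fderiv ℝ lam y (1, 0)) x (1, 0) = a at *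
      generalize fderiv ℝ (fun y => fderiv ℝ lam y (0, 1)) x (0, 1) = b at *
      generalize fderiv ℝ lam x (1, 0) = p at *
      generalize fderiv ℝ lam x (0, 1) = q at *
      have key : ε * a + η * b =
          -lam x - 2 * lam x / (τ - lam x ^ 2) * (ε * p ^ 2 + η * q ^ 2) := by linarith
      calc _ = -τ / lam x ^ 2 * (ε * a + η * b) + (2 * τ / lam x ^ 3
            - 2 * lam x / (τ - lam x ^ 2) * (τ ^ 2 / lam x ^ 4)) * (ε * p ^ 2 + η * q ^ 2) := by
            ring
        _ = τ / lam x := by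
            rw [key]
            field_simp
            ring
    · have := h x hx
      rw [hcoef x hx]
      simp only [gradSq]
      linarith
    · simp only [pd1, pd2, hgrad x hx]
      ring
end

section
/- Let ε, η ∈ {−1, 1}, let τ > 0 be a constant, let Ω ⊆ ℝ² be open, and let λ : Ω → ℝ be a smooth function with |λ(x)| < √τ for all x ∈ Ω. Define Ψ := −2 artanh(λ/√τ). Then λ satisfies Δ₀λ + (2λ/(τ−λ²))(ε(∂₁λ)² + η(∂₂λ)²) = −λ on Ω if and only if Ψ satisfies the sinh-Gordon equation Δ₀Ψ = −sinh Ψ on Ω, where Δ₀f := ε∂₁²f + η∂₂²f. -/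
/-- The inverse hyperbolic tangent, `artanh x = (1/2) ln((1+x)/(1−x))`. -/
noncomputable def artanh (x : ℝ) : ℝ := (1 / 2) * Real.log ((1 + x) / (1 - x))

open Filter Topology in
/-- Second directional derivative of a composition `g ∘ f` with `g` a function of one variable. -/
theorem fderiv_fderiv_comp_apply {E : Type*} [NormedAddCommGroup E] [NormedSpace ℝ E]
    {f : E → ℝ} {g g' : ℝ → ℝ} {g'' : ℝ} {x : E} (hf : ContDiffAt ℝ 2 f x)
    (hg : ∀ᶠ t in 𝓝 (f x), HasDerivAt g (g' t) t) (hg' : HasDerivAt g' g'' (f x)) (v : E) :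
    fderiv ℝ (fun y => fderiv ℝ (fun z => g (f z)) y v) x v =
      g'' * fderiv ℝ f x v ^ 2 + g' (f x) * fderiv ℝ (fun y => fderiv ℝ f y v) x v := by
  have hfirst : (fun y => fderiv ℝ (fun z => g (f z)) y v) =ᶠ[𝓝 x]
      fun y => g' (f y) * fderiv ℝ f y v := by
    filter_upwards [hf.continuousAt.eventually hg, hf.eventually (by simp)] with y hgy hfy
    have hd : HasFDerivAt (fun z => g (f z)) (g' (f y) • fderiv ℝ f y) y :=
      hgy.comp_hasFDerivAt y (hfy.differentiableAt (by simp)).hasFDerivAt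
    simp [hd.fderiv]
  have hd : DifferentiableAt ℝ (fun y => fderiv ℝ f y v) x :=
    ((hf.fderiv_right (m := 1) (by norm_num)).differentiableAt (by simp)).clm_apply
      (differentiableAt_const v)
  have hg'f : HasFDerivAt (fun y => g' (f y)) (g'' • fderiv ℝ f x) x :=
    hg'.comp_hasFDerivAt x (hf.differentiableAt (by simp)).hasFDerivAt
  rw [hfirst.fderiv_eq, (hg'f.fun_mul hd.hasFDerivAt).fderiv]
  simp
  ring

theorem hasDerivAt_artanh {t : ℝ} (ht : |t| < 1) : HasDerivAt artanh (1 / (1 - t ^ 2)) t := by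
  obtain ⟨h₁, h₂⟩ := abs_lt.1 ht
  have hp : 1 + t ≠ 0 := by linarith
  have hm : 1 - t ≠ 0 := by linarith
  have hsq : 1 - t ^ 2 ≠ 0 := by
    rw [show 1 - t ^ 2 = (1 + t) * (1 - t) by ring]
    exact mul_ne_zero hp hm
  have h := (((((hasDerivAt_id t).const_add 1).div ((hasDerivAt_id t).const_sub 1) hm).log
    (div_ne_zero hp hm)).const_mul (1 / 2))
  refine h.congr_deriv ?_
  simp only [id, Pi.div_apply]
  field_simp
  ring

theorem sinh_neg_two_mul_artanh {t : ℝ} (ht : |t| < 1) :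
    Real.sinh (-2 * artanh t) = -(2 * t / (1 - t ^ 2)) := by
  obtain ⟨h₁, h₂⟩ := abs_lt.1 ht
  have hp : 0 < 1 + t := by linarith
  have hm : 0 < 1 - t := by linarith
  have hsq : 1 - t ^ 2 ≠ 0 := by
    rw [show 1 - t ^ 2 = (1 + t) * (1 - t) by ring]
    exact (mul_pos hp hm).ne'
  rw [show -2 * artanh t = -Real.log ((1 + t) / (1 - t)) by rw [artanh]; ring, Real.sinh_neg,
    Real.sinh_log (div_pos hp hm)]
  field_simp
  ring

theorem hasDerivAt_neg_two_mul_artanh_div {s t : ℝ} (ht : |t| < s) :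
    HasDerivAt (fun u => -2 * artanh (u / s)) (-2 * s / (s ^ 2 - t ^ 2)) t := by
  have hs : 0 < s := (abs_nonneg t).trans_lt ht
  have hts : |t / s| < 1 := by rwa [abs_div, abs_of_pos hs, div_lt_one hs]
  have hsq : s ^ 2 - t ^ 2 ≠ 0 := (sub_pos.2 (sq_lt_sq.2 (by rwa [abs_of_pos hs]))).ne'
  refine (((hasDerivAt_artanh hts).comp t ((hasDerivAt_id t).div_const s)).const_mul
    (-2)).congr_deriv ?_
  have : 1 - (t / s) ^ 2 = (s ^ 2 - t ^ 2) / s ^ 2 := by field_simp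
  rw [this]
  field_simp

theorem hasDerivAt_neg_two_mul_div_sq_sub_sq {s t : ℝ} (ht : s ^ 2 - t ^ 2 ≠ 0) :
    HasDerivAt (fun u => -2 * s / (s ^ 2 - u ^ 2)) (-4 * s * t / (s ^ 2 - t ^ 2) ^ 2) t := by
  refine ((hasDerivAt_const t (-2 * s)).div ((hasDerivAt_pow 2 t).const_sub (s ^ 2))
    ht).congr_deriv ?_
  simp
  ring

/-- case `τ > 0` of Theorem 1. With `Ψ = −2 artanh(λ/√τ)`,
equation (2.21) for `λ` on `Ω` is equivalent to the sinh-Gordon equation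
`Δ₀Ψ = −sinh Ψ` on `Ω`. -/
theorem stmt2 (ε η τ : ℝ) (hε : ε = 1 ∨ ε = -1) (hη : η = 1 ∨ η = -1) (hτ : 0 < τ)
    (Ω : Set (ℝ × ℝ)) (hΩ : IsOpen Ω)
    (lam : ℝ × ℝ → ℝ) (hlam : ContDiffOn ℝ (⊤ : ℕ∞) lam Ω)
    (hbd : ∀ x ∈ Ω, |lam x| < Real.sqrt τ)
    (Ψ : ℝ × ℝ → ℝ) (hΨ : Ψ = fun x => -2 * artanh (lam x / Real.sqrt τ)) :
    (∀ x ∈ Ω,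
        lap0 ε η lam x + (2 * lam x / (τ - lam x ^ 2)) *
          (ε * (pd1 lam x) ^ 2 + η * (pd2 lam x) ^ 2) = -lam x)
    ↔ (∀ x ∈ Ω, lap0 ε η Ψ x = -Real.sinh (Ψ x)) := by
  obtain ⟨s, hs, rfl⟩ : ∃ s : ℝ, 0 < s ∧ s ^ 2 = τ :=
    ⟨√τ, Real.sqrt_pos.2 hτ, Real.sq_sqrt hτ.le⟩
  rw [Real.sqrt_sq hs.le] at hbd hΨ
  subst hΨ
  refine forall₂_congr fun x hx => ?_
  have hb := hbd x hx
  have hsq : 0 < s ^ 2 - lam x ^ 2 := sub_pos.2 (sq_lt_sq.2 (by rwa [abs_of_pos hs]))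
  have hf : ContDiffAt ℝ 2 lam x :=
    (hlam.contDiffAt (hΩ.mem_nhds hx)).of_le (WithTop.coe_le_coe.2 le_top)
  have hg : ∀ᶠ t in nhds (lam x),
      HasDerivAt (fun u => -2 * artanh (u / s)) (-2 * s / (s ^ 2 - t ^ 2)) t :=
    (continuous_abs.continuousAt.eventually_lt_const hb).mono
      fun t ht => hasDerivAt_neg_two_mul_artanh_div ht
  have hsecond := fderiv_fderiv_comp_apply hf hg (hasDerivAt_neg_two_mul_div_sq_sub_sq hsq.ne')
  have hsinh : Real.sinh (-2 * artanh (lam x / s)) = -(2 * s * lam x / (s ^ 2 - lam x ^ 2)) := by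
    rw [sinh_neg_two_mul_artanh (by rwa [abs_div, abs_of_pos hs, div_lt_one hs]),
      show 1 - (lam x / s) ^ 2 = (s ^ 2 - lam x ^ 2) / s ^ 2 by field_simp]
    field_simp
  have hlap : lap0 ε η (fun x => -2 * artanh (lam x / s)) x =
      -2 * s / (s ^ 2 - lam x ^ 2) * (lap0 ε η lam x + (2 * lam x / (s ^ 2 - lam x ^ 2)) *
          (ε * (pd1 lam x) ^ 2 + η * (pd2 lam x) ^ 2)) := by
    unfold lap0 pd1 pd2
    rw [hsecond, hsecond]
    field_simp
    ring
  have hc : -2 * s / (s ^ 2 - lam x ^ 2) ≠ 0 := div_ne_zero (by linarith) hsq.ne'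
  rw [hlap, hsinh, show - -(2 * s * lam x / (s ^ 2 - lam x ^ 2)) =
    -2 * s / (s ^ 2 - lam x ^ 2) * -lam x by ring, mul_right_inj' hc]
end

section
/- Let ε, η ∈ {−1, 1}, let Ω ⊆ ℝ² be open, and let μ : Ω → ℝ be a smooth nowhere-vanishing function. Define Ψ := 1/μ. Then μ satisfies Δ₀μ − (2/μ)(ε(∂₁μ)² + η(∂₂μ)²) = μ on Ω if and only if Ψ satisfies Δ₀Ψ = −Ψ on Ω, where Δ₀f := ε∂₁²f + η∂₂²f. -/
/-- Derivative of `1 / f` in the direction `v`. -/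
theorem fderiv_one_div_apply {E : Type*} [NormedAddCommGroup E] [NormedSpace ℝ E]
    {f : E → ℝ} {x : E} (hf : DifferentiableAt ℝ f x) (hx : f x ≠ 0) (v : E) :
    fderiv ℝ (fun y => 1 / f y) x v = -(fderiv ℝ f x v) / f x ^ 2 := by
  have h : HasFDerivAt (fun y => 1 / f y) (-(f x ^ 2)⁻¹ • fderiv ℝ f x) x := by
    simpa only [one_div, Function.comp_def] using
      (hasDerivAt_inv hx).comp_hasFDerivAt x hf.hasFDerivAt
  rw [h.fderiv, smul_apply, smul_eq_mul]
  ring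

/-- Second derivative of `1 / f` in the direction `v`. -/
theorem fderiv_fderiv_one_div_apply {E : Type*} [NormedAddCommGroup E] [NormedSpace ℝ E]
    {f : E → ℝ} {x : E} (hf : ContDiffAt ℝ 2 f x) (hx : f x ≠ 0) (v : E) :
    fderiv ℝ (fun y => fderiv ℝ (fun z => 1 / f z) y v) x v =
      -(fderiv ℝ (fun y => fderiv ℝ f y v) x v) / f x ^ 2
        + 2 * (fderiv ℝ f x v) ^ 2 / f x ^ 3 := by
  have hd : DifferentiableAt ℝ f x := hf.differentiableAt (by norm_num)
  have hev : (fun y => fderiv ℝ (fun z => 1 / f z) y v) =ᶠ[nhds x]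
      fun y => -(fderiv ℝ f y v) * ((1 / f y) * (1 / f y)) := by
    filter_upwards [hf.eventually (by simp), hf.continuousAt.eventually_ne hx] with y hy hy0
    rw [fderiv_one_div_apply (hy.differentiableAt (by norm_num)) hy0]
    ring
  have hg : DifferentiableAt ℝ (fun y => fderiv ℝ f y v) x :=
    ((hf.fderiv_right (m := 1) (by norm_num)).differentiableAt (by norm_num)).clm_apply
      (differentiableAt_const v)
  have hi : DifferentiableAt ℝ (fun y => 1 / f y) x := by
    simpa only [one_div] using hd.fun_inv hx
  have h := hg.hasFDerivAt.fun_neg.fun_mul (hi.hasFDerivAt.fun_mul hi.hasFDerivAt)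
  rw [hev.fderiv_eq, h.fderiv]
  simp only [add_apply, smul_apply,
    neg_apply, smul_eq_mul, fderiv_one_div_apply hd hx]
  field_simp
  ring

/-- Transformation of `Δ₀` under `f ↦ 1 / f`. -/
theorem lap0_one_div (ε η : ℝ) {f : ℝ × ℝ → ℝ} {x : ℝ × ℝ} (hf : ContDiffAt ℝ 2 f x)
    (hx : f x ≠ 0) :
    lap0 ε η (fun y => 1 / f y) x =
      -(lap0 ε η f x - (2 / f x) * (ε * (pd1 f x) ^ 2 + η * (pd2 f x) ^ 2)) / f x ^ 2 := by
  unfold lap0 pd1 pd2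
  rw [fderiv_fderiv_one_div_apply hf hx, fderiv_fderiv_one_div_apply hf hx]
  field_simp
  ring

/-- case `τ = 0` of Theorem 1. With `Ψ = 1/μ`, the equation
`Δ₀μ − (2/μ)(ε(∂₁μ)² + η(∂₂μ)²) = μ` on `Ω` is equivalent to the linear
equation `Δ₀Ψ = −Ψ` on `Ω`. -/
theorem stmt3 (ε η : ℝ) (hε : ε = 1 ∨ ε = -1) (hη : η = 1 ∨ η = -1)
    (Ω : Set (ℝ × ℝ)) (hΩ : IsOpen Ω)
    (μ : ℝ × ℝ → ℝ) (hμ : ContDiffOn ℝ (⊤ : ℕ∞) μ Ω)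
    (hne : ∀ x ∈ Ω, μ x ≠ 0)
    (Ψ : ℝ × ℝ → ℝ) (hΨ : Ψ = fun x => 1 / μ x) :
    (∀ x ∈ Ω,
        lap0 ε η μ x - (2 / μ x) * (ε * (pd1 μ x) ^ 2 + η * (pd2 μ x) ^ 2) = μ x)
    ↔ (∀ x ∈ Ω, lap0 ε η Ψ x = -Ψ x) := by
  subst hΨ
  refine forall₂_congr fun x hx => ?_
  have hc : ContDiffAt ℝ 2 μ x :=
    contDiffAt_infty.1 (hμ.contDiffAt (hΩ.mem_nhds hx)) 2
  have h0 := hne x hx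
  rw [lap0_one_div ε η hc h0, ← neg_div, div_eq_div_iff (pow_ne_zero 2 h0) h0,
    show -1 * μ x ^ 2 = -μ x * μ x by ring, mul_left_inj' h0, neg_inj]
end

section
/- Let ε, η ∈ {−1, 1}, let τ < 0 be a constant, let Ω ⊆ ℝ² be open, and let λ : Ω → ℝ be a smooth function. Define Ψ := 2 arctan(λ/√(−τ)) − π. Then λ satisfies Δ₀λ + (2λ/(τ−λ²))(ε(∂₁λ)² + η(∂₂λ)²) = −λ on Ω if and only if Ψ satisfies the sine-Gordon equation Δ₀Ψ = sin Ψ on Ω, where Δ₀f := ε∂₁²f + η∂₂²f. -/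
theorem Real.sin_two_mul_arctan (u : ℝ) :
    Real.sin (2 * Real.arctan u) = 2 * u / (1 + u ^ 2) := by
  have h : 0 < 1 + u ^ 2 := by positivity
  rw [Real.sin_two_mul, Real.sin_arctan, Real.cos_arctan]
  have hs := Real.sq_sqrt h.le
  have hs0 : Real.sqrt (1 + u ^ 2) ≠ 0 := (Real.sqrt_pos.2 h).ne'
  field_simp
  rw [hs]

section ArctanSubstitution

variable {E : Type*} [NormedAddCommGroup E] [NormedSpace ℝ E] {f : E → ℝ} {x : E} {s : ℝ}

theorem HasFDerivAt.two_mul_arctan_div_sub_const {f' : E →L[ℝ] ℝ} (hs : s ≠ 0)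
    (hf : HasFDerivAt f f' x) (c : ℝ) :
    HasFDerivAt (fun y => 2 * Real.arctan (f y / s) - c) ((2 * s / (s ^ 2 + f x ^ 2)) • f') x := by
  have hd : HasDerivAt (fun t : ℝ => 2 * Real.arctan (t / s) - c)
      (2 * s / (s ^ 2 + f x ^ 2)) (f x) := by
    have h := ((((hasDerivAt_id (f x)).div_const s).arctan).const_mul 2).sub_const c
    refine h.congr_deriv ?_
    have : s ^ 2 + f x ^ 2 ≠ 0 := by positivity
    simp only [id]
    field_simp
  exact hd.comp_hasFDerivAt x hf

theorem fderiv_fderiv_two_mul_arctan_div_sub_const (hs : s ≠ 0) (hf : ContDiffAt ℝ 2 f x)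
    (c : ℝ) (v : E) :
    fderiv ℝ (fun y => fderiv ℝ (fun z => 2 * Real.arctan (f z / s) - c) y v) x v =
      2 * s / (s ^ 2 + f x ^ 2) * (fderiv ℝ (fun y => fderiv ℝ f y v) x v -
        2 * f x / (s ^ 2 + f x ^ 2) * (fderiv ℝ f x v) ^ 2) := by
  have hfx : HasFDerivAt f (fderiv ℝ f x) x :=
    (hf.differentiableAt (by norm_num)).hasFDerivAt
  have hfirst : (fun y => fderiv ℝ (fun z => 2 * Real.arctan (f z / s) - c) y v) =ᶠ[nhds x]
      fun y => 2 * s / (s ^ 2 + f y ^ 2) * fderiv ℝ f y v := by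
    filter_upwards [hf.eventually (by simp)] with y hy
    have hfy := (hy.differentiableAt (by norm_num)).hasFDerivAt
    simp [(hfy.two_mul_arctan_div_sub_const hs c).fderiv]
  have hdir : HasFDerivAt (fun y => fderiv ℝ f y v)
      (fderiv ℝ (fun y => fderiv ℝ f y v) x) x :=
    (((hf.fderiv_right (m := 1) (by norm_num)).differentiableAt (by norm_num)).clm_apply
      (differentiableAt_const v)).hasFDerivAt
  have hpos : s ^ 2 + f x ^ 2 ≠ 0 := by positivity
  have hcoef : HasFDerivAt (fun y => 2 * s / (s ^ 2 + f y ^ 2))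
      ((-(4 * s * f x) / (s ^ 2 + f x ^ 2) ^ 2) • fderiv ℝ f x) x := by
    have hd : HasDerivAt (fun t : ℝ => 2 * s / (s ^ 2 + t ^ 2))
        (-(4 * s * f x) / (s ^ 2 + f x ^ 2) ^ 2) (f x) := by
      have h := (hasDerivAt_const (f x) (2 * s)).fun_div
        (((hasDerivAt_id (f x)).fun_pow 2).const_add (s ^ 2)) hpos
      refine h.congr_deriv ?_
      simp only [id]
      push_cast
      ring
    exact hd.comp_hasFDerivAt x hfx
  rw [hfirst.fderiv_eq, (hcoef.fun_mul hdir).fderiv]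
  simp only [add_apply, smul_apply, smul_eq_mul]
  field_simp
  ring

end ArctanSubstitution

/-- case `τ < 0` of Theorem 1. With `Ψ = 2 arctan(λ/√(−τ)) − π`,
equation (2.21) for `λ` on `Ω` is equivalent to the sine-Gordon equation
`Δ₀Ψ = sin Ψ` on `Ω`. -/
theorem stmt4 (ε η τ : ℝ) (hε : ε = 1 ∨ ε = -1) (hη : η = 1 ∨ η = -1) (hτ : τ < 0)
    (Ω : Set (ℝ × ℝ)) (hΩ : IsOpen Ω)
    (lam : ℝ × ℝ → ℝ) (hlam : ContDiffOn ℝ (⊤ : ℕ∞) lam Ω)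
    (Ψ : ℝ × ℝ → ℝ)
    (hΨ : Ψ = fun x => 2 * Real.arctan (lam x / Real.sqrt (-τ)) - Real.pi) :
    (∀ x ∈ Ω,
        lap0 ε η lam x + (2 * lam x / (τ - lam x ^ 2)) *
          (ε * (pd1 lam x) ^ 2 + η * (pd2 lam x) ^ 2) = -lam x)
    ↔ (∀ x ∈ Ω, lap0 ε η Ψ x = Real.sin (Ψ x)) := by
  subst hΨ
  set s := Real.sqrt (-τ) with hs_def
  have hs : s ≠ 0 := (Real.sqrt_pos.2 (neg_pos.2 hτ)).ne'
  have hτs : τ = -s ^ 2 := by rw [hs_def, Real.sq_sqrt (neg_pos.2 hτ).le, neg_neg]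
  refine forall₂_congr fun x hx => ?_
  have hf : ContDiffAt ℝ 2 lam x :=
    (hlam.contDiffAt (hΩ.mem_nhds hx)).of_le (WithTop.coe_le_coe.2 (le_top : (2 : ℕ∞) ≤ ⊤))
  have hpos : s ^ 2 + lam x ^ 2 ≠ 0 := by positivity
  have hsin : Real.sin (2 * Real.arctan (lam x / s) - Real.pi) =
      2 * s / (s ^ 2 + lam x ^ 2) * -lam x := by
    rw [Real.sin_sub_pi, Real.sin_two_mul_arctan]
    field_simp
  have hlap : lap0 ε η (fun x => 2 * Real.arctan (lam x / s) - Real.pi) x =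
      2 * s / (s ^ 2 + lam x ^ 2) * (lap0 ε η lam x + (2 * lam x / (τ - lam x ^ 2)) *
          (ε * (pd1 lam x) ^ 2 + η * (pd2 lam x) ^ 2)) := by
    have hden : τ - lam x ^ 2 = -(s ^ 2 + lam x ^ 2) := by rw [hτs]; ring
    unfold lap0 pd1 pd2
    simp only [fderiv_fderiv_two_mul_arctan_div_sub_const hs hf, hden, div_neg]
    ring
  rw [hlap, hsin]
  exact (mul_right_inj' (div_ne_zero (mul_ne_zero two_ne_zero hs) hpos)).symm
end

section
/- Let H ∈ ℝ, let Ω ⊆ ℝ² be open, and let u : Ω → ℝ be a smooth function satisfying the Liouville equation ∂₁∂₂u = H e^{−u} on Ω. Then on Ω the functions 2∂₂²u + (∂₂u)² and ∂₂³u + ∂₂u·∂₂²u have vanishing partial derivative with respect to the first variable: ∂₁(2∂₂²u + (∂₂u)²) = 0 and ∂₁(∂₂³u + ∂₂u·∂₂²u) = 0. -/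
/-- On an open set, the second partial derivative of a smooth function is smooth. -/
theorem ContDiffOn.pd2 {f : ℝ × ℝ → ℝ} {Ω : Set (ℝ × ℝ)} (hf : ContDiffOn ℝ (⊤ : ℕ∞) f Ω)
    (hΩ : IsOpen Ω) : ContDiffOn ℝ (⊤ : ℕ∞) (pd2 f) Ω :=
  (hf.fderiv_of_isOpen (m := (⊤ : ℕ∞)) hΩ (by simp)).clm_apply contDiffOn_const

/-- Partial derivatives of a smooth function on an open set commute. -/
theorem pd1_pd2_comm {f : ℝ × ℝ → ℝ} {Ω : Set (ℝ × ℝ)} (hf : ContDiffOn ℝ (⊤ : ℕ∞) f Ω)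
    (hΩ : IsOpen Ω) {x : ℝ × ℝ} (hx : x ∈ Ω) : pd1 (pd2 f) x = pd2 (pd1 f) x := by
  have hfx : ContDiffAt ℝ 2 f x := contDiffAt_infty.1 (hf.contDiffAt (hΩ.mem_nhds hx)) 2
  have hd : DifferentiableAt ℝ (fderiv ℝ f) x :=
    (hfx.fderiv_right (m := 1) one_add_one_eq_two.le).differentiableAt one_ne_zero
  have hsymm : IsSymmSndFDerivAt ℝ f x :=
    hfx.isSymmSndFDerivAt (by simp)
  have happly (v w : ℝ × ℝ) :
      fderiv ℝ (fun y => fderiv ℝ f y v) x w = fderiv ℝ (fderiv ℝ f) x w v := by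
    rw [fderiv_clm_apply hd (differentiableAt_const v)]
    simp
  change fderiv ℝ (fun y => fderiv ℝ f y (0, 1)) x (1, 0) =
    fderiv ℝ (fun y => fderiv ℝ f y (1, 0)) x (0, 1)
  rw [happly, happly, hsymm.eq]

/-- The second partial derivative at a point of an open set depends only on the values there. -/
theorem pd2_congr {f g : ℝ × ℝ → ℝ} {Ω : Set (ℝ × ℝ)} (hΩ : IsOpen Ω) (h : Set.EqOn f g Ω)
    {x : ℝ × ℝ} (hx : x ∈ Ω) : pd2 f x = pd2 g x := by
  unfold pd2
  rw [(h.eventuallyEq_of_mem (hΩ.mem_nhds hx)).fderiv_eq]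

/-- if `u` solves the Liouville equation `∂₁∂₂u = H e^{−u}` on the
open set `Ω`, then the functions `2∂₂²u + (∂₂u)²` and `∂₂³u + ∂₂u·∂₂²u` do not
depend on the first variable: their `∂₁`-derivatives vanish on `Ω`. -/
theorem stmt8 (H : ℝ) (Ω : Set (ℝ × ℝ)) (hΩ : IsOpen Ω)
    (u : ℝ × ℝ → ℝ) (hu : ContDiffOn ℝ (⊤ : ℕ∞) u Ω)
    (heq : ∀ x ∈ Ω, pd1 (pd2 u) x = H * Real.exp (-u x)) :
    (∀ x ∈ Ω, pd1 (fun y => 2 * pd2 (pd2 u) y + (pd2 u y) ^ 2) x = 0) ∧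
    (∀ x ∈ Ω, pd1 (fun y => pd2 (pd2 (pd2 u)) y + pd2 u y * pd2 (pd2 u) y) x = 0) := by
  have hv := hu.pd2 hΩ
  have hw := hv.pd2 hΩ
  have hdiff {f : ℝ × ℝ → ℝ} (hf : ContDiffOn ℝ (⊤ : ℕ∞) f Ω) {x : ℝ × ℝ} (hx : x ∈ Ω) :
      DifferentiableAt ℝ f x :=
    (hf.contDiffAt (hΩ.mem_nhds hx)).differentiableAt (by simp)
  have hfirst : ∀ x ∈ Ω, pd1 (fun y => 2 * pd2 (pd2 u) y + (pd2 u y) ^ 2) x = 0 := by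
    intro x hx
    have hexp : pd1 (pd2 (pd2 u)) x = -(pd2 u x * (H * Real.exp (-u x))) := by
      rw [pd1_pd2_comm hv hΩ hx, pd2_congr hΩ heq hx]
      have h := ((hdiff hu hx).hasFDerivAt.neg.exp.const_mul H).fderiv
      simp only [pd2]
      erw [h]
      simp
      ring
    have h := ((hdiff hw hx).hasFDerivAt.const_mul 2).add ((hdiff hv hx).hasFDerivAt.pow 2)
    have hv1 := heq x hx
    unfold pd1 at hexp hv1 ⊢
    erw [h.fderiv]
    simp [hexp, hv1]
    ring
  refine ⟨hfirst, fun x hx => ?_⟩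
  have hsmooth : ContDiffOn ℝ (⊤ : ℕ∞) (fun y => 2 * pd2 (pd2 u) y + (pd2 u y) ^ 2) Ω :=
    (contDiffOn_const.mul hw).add (hv.pow 2)
  have hpd2 : Set.EqOn (fun y => pd2 (pd2 (pd2 u)) y + pd2 u y * pd2 (pd2 u) y)
      (fun y => 2⁻¹ * pd2 (fun y => 2 * pd2 (pd2 u) y + (pd2 u y) ^ 2) y) Ω := by
    intro y hy
    have h := ((hdiff hw hy).hasFDerivAt.const_mul 2).add ((hdiff hv hy).hasFDerivAt.pow 2)
    have h2 : pd2 (fun y => 2 * pd2 (pd2 u) y + (pd2 u y) ^ 2) y =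
        2 * pd2 (pd2 (pd2 u)) y + 2 * pd2 u y * pd2 (pd2 u) y := by
      conv_lhs => unfold pd2
      erw [h.fderiv]
      simp [pd2]
    simp only [h2]
    ring
  have hcomm := pd1_pd2_comm hsmooth hΩ hx
  rw [pd2_congr (g := fun _ => 0) hΩ hfirst hx] at hcomm
  have hzero : pd2 (fun _ => 0) x = 0 := by simp [pd2]
  rw [hzero] at hcomm
  unfold pd1 at hcomm ⊢
  rw [(hpd2.eventuallyEq_of_mem (hΩ.mem_nhds hx)).fderiv_eq,
    fderiv_const_mul (hdiff (hsmooth.pd2 hΩ) hx)]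
  simp [hcomm]
end

section
/- Let a, b ∈ ℝ with (a, b) ≠ (0, 0) and set λ := √(a² + b²). Let K : ℝ² × ℝ² → ℝ² be the symmetric bilinear map determined by K(e₁,e₁) = a e₁ + b e₂, K(e₁,e₂) = K(e₂,e₁) = b e₁ − a e₂, K(e₂,e₂) = −a e₁ − b e₂, where (e₁, e₂) is the standard basis of ℝ². Then there exists φ ∈ ℝ such that the orthonormal basis X := sin(φ) e₁ − cos(φ) e₂, Y := cos(φ) e₁ + sin(φ) e₂ satisfies K(X,X) = −λY, K(X,Y) = K(Y,X) = −λX, and K(Y,Y) = λY. -/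
/-- A symmetric bilinear map on `ℝ²` of the `(a, b)`-form, in coordinates. -/
lemma apply_eq_of_basis (a b : ℝ) (K : (ℝ × ℝ) →ₗ[ℝ] (ℝ × ℝ) →ₗ[ℝ] (ℝ × ℝ))
    (hsymm : ∀ x y : ℝ × ℝ, K x y = K y x)
    (h11 : K (1, 0) (1, 0) = (a, b))
    (h12 : K (1, 0) (0, 1) = (b, -a))
    (h22 : K (0, 1) (0, 1) = (-a, -b)) (x y u v : ℝ) :
    K (x, y) (u, v) =
      (a * (x * u - y * v) + b * (x * v + y * u), b * (x * u - y * v) - a * (x * v + y * u)) := by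
  have h21 : K (0, 1) (1, 0) = (b, -a) := (hsymm _ _).trans h12
  have decomp (p q : ℝ) : ((p, q) : ℝ × ℝ) = p • (1, 0) + q • (0, 1) := by simp
  rw [decomp x y, decomp u v]
  simp only [map_add, map_smul, LinearMap.add_apply, LinearMap.smul_apply, h11, h12, h21, h22]
  ext <;> simp <;> ring

/-- Polar coordinates with the angle divided by three. -/
lemma exists_polar_three_mul (a b : ℝ) :
    ∃ φ : ℝ, a = √(a ^ 2 + b ^ 2) * Real.cos (3 * φ) ∧ b = √(a ^ 2 + b ^ 2) * Real.sin (3 * φ) := by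
  refine ⟨Complex.arg ⟨a, b⟩ / 3, ?_⟩
  have hnorm : √(a ^ 2 + b ^ 2) = ‖(⟨a, b⟩ : ℂ)‖ := by
    rw [Complex.norm_eq_sqrt_sq_add_sq]
  rw [mul_div_cancel₀ _ (three_ne_zero' ℝ), hnorm, Complex.norm_mul_cos_arg,
    Complex.norm_mul_sin_arg]
  exact ⟨rfl, rfl⟩

/-- pointwise content of Lemma A. If the symmetric bilinear map
`K` on `ℝ²` has the `(a,b)`-form `K(e₁,e₁) = ae₁ + be₂`, `K(e₁,e₂) = be₁ − ae₂`,
`K(e₂,e₂) = −ae₁ − be₂` with `(a,b) ≠ (0,0)` and `λ = √(a² + b²)`, then there is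
a rotated orthonormal basis `X = sin φ e₁ − cos φ e₂`, `Y = cos φ e₁ + sin φ e₂`
in which `K(X,X) = −λY`, `K(X,Y) = −λX`, `K(Y,Y) = λY`. -/
theorem stmt11 (a b : ℝ) (hab : (a, b) ≠ ((0 : ℝ), (0 : ℝ)))
    (lam : ℝ) (hlam : lam = Real.sqrt (a ^ 2 + b ^ 2))
    (K : (ℝ × ℝ) →ₗ[ℝ] (ℝ × ℝ) →ₗ[ℝ] (ℝ × ℝ))
    (hsymm : ∀ x y : ℝ × ℝ, K x y = K y x)
    (h11 : K (1, 0) (1, 0) = (a, b))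
    (h12 : K (1, 0) (0, 1) = (b, -a))
    (h22 : K (0, 1) (0, 1) = (-a, -b)) :
    ∃ φ : ℝ,
      K (Real.sin φ, -Real.cos φ) (Real.sin φ, -Real.cos φ)
          = (-lam) • (Real.cos φ, Real.sin φ) ∧
      K (Real.sin φ, -Real.cos φ) (Real.cos φ, Real.sin φ)
          = (-lam) • (Real.sin φ, -Real.cos φ) ∧
      K (Real.cos φ, Real.sin φ) (Real.sin φ, -Real.cos φ)
          = (-lam) • (Real.sin φ, -Real.cos φ) ∧
      K (Real.cos φ, Real.sin φ) (Real.cos φ, Real.sin φ)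
          = lam • (Real.cos φ, Real.sin φ) := by
  obtain ⟨φ, ha, hb⟩ := exists_polar_three_mul a b
  rw [← hlam] at ha hb
  have hcos : a * (Real.cos φ ^ 2 - Real.sin φ ^ 2) + b * (2 * Real.sin φ * Real.cos φ)
      = lam * Real.cos φ := by
    rw [← Real.cos_two_mul', ← Real.sin_two_mul, ha, hb]
    have h := Real.cos_sub (3 * φ) (2 * φ)
    rw [show 3 * φ - 2 * φ = φ by ring] at h
    linear_combination -lam * h
  have hsin : b * (Real.cos φ ^ 2 - Real.sin φ ^ 2) - a * (2 * Real.sin φ * Real.cos φ)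
      = lam * Real.sin φ := by
    rw [← Real.cos_two_mul', ← Real.sin_two_mul, ha, hb]
    have h := Real.sin_sub (3 * φ) (2 * φ)
    rw [show 3 * φ - 2 * φ = φ by ring] at h
    linear_combination -lam * h
  refine ⟨φ, ?_⟩
  simp only [apply_eq_of_basis a b K hsymm h11 h12 h22, Prod.smul_mk, smul_eq_mul, Prod.mk.injEq]
  refine ⟨⟨?_, ?_⟩, ⟨?_, ?_⟩, ⟨?_, ?_⟩, ⟨?_, ?_⟩⟩
  · linear_combination -hcos
  · linear_combination -hsin
  · linear_combination -hsin
  · linear_combination hcos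
  · linear_combination -hsin
  · linear_combination hcos
  · linear_combination hcos
  · linear_combination hsin
end

section
/- Let a, b ∈ ℝ with (a, b) ≠ (0, 0) and set λ := √(a² + b²). Let K : ℝ² × ℝ² → ℝ² be the symmetric bilinear map determined by K(e₁,e₁) = a e₁ + b e₂, K(e₁,e₂) = K(e₂,e₁) = b e₁ − a e₂, K(e₂,e₂) = −a e₁ − b e₂, where (e₁, e₂) is the standard basis of ℝ². For θ ∈ ℝ write v_θ := (cos θ, sin θ). Then for all θ ∈ ℝ the standard inner product satisfies ⟨K(v_θ, v_θ), v_θ⟩ = a cos(3θ) + b sin(3θ); consequently, if θ, θ' ∈ ℝ satisfy ⟨K(v_θ, v_θ), v_θ⟩ = 0 and ⟨K(v_{θ'}, v_{θ'}), v_{θ'}⟩ = 0, then θ − θ' is an integer multiple of π/3. -/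
/-- Two zeros of a nontrivial combination of `cos` and `sin` differ by a zero of `sin`. -/
theorem sin_sub_eq_zero_of_cos_sin_comb {a b x y : ℝ} (hab : (a, b) ≠ ((0 : ℝ), (0 : ℝ)))
    (hx : a * Real.cos x + b * Real.sin x = 0) (hy : a * Real.cos y + b * Real.sin y = 0) :
    Real.sin (x - y) = 0 := by
  rw [Real.sin_sub]
  by_contra hne
  refine hab (Prod.ext ?_ ?_)
  · refine (mul_eq_zero.mp ?_).resolve_right hne
    linear_combination Real.sin x * hy - Real.sin y * hx
  · refine (mul_eq_zero.mp ?_).resolve_right hne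
    linear_combination Real.cos y * hx - Real.cos x * hy

/-- the angle between null directions of the cubic form is a
multiple of `π/3`. If the symmetric bilinear map `K` on `ℝ²` has the
`(a,b)`-form of Lemma A with `(a,b) ≠ (0,0)`, then
`⟨K(v_θ, v_θ), v_θ⟩ = a cos 3θ + b sin 3θ` for `v_θ = (cos θ, sin θ)`, and any
two null directions `θ, θ'` differ by an integer multiple of `π/3`. -/
theorem stmt12 (a b : ℝ) (hab : (a, b) ≠ ((0 : ℝ), (0 : ℝ)))
    (K : (ℝ × ℝ) →ₗ[ℝ] (ℝ × ℝ) →ₗ[ℝ] (ℝ × ℝ))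
    (hsymm : ∀ x y : ℝ × ℝ, K x y = K y x)
    (h11 : K (1, 0) (1, 0) = (a, b))
    (h12 : K (1, 0) (0, 1) = (b, -a))
    (h22 : K (0, 1) (0, 1) = (-a, -b)) :
    (∀ θ : ℝ,
      (K (Real.cos θ, Real.sin θ) (Real.cos θ, Real.sin θ)).1 * Real.cos θ
        + (K (Real.cos θ, Real.sin θ) (Real.cos θ, Real.sin θ)).2 * Real.sin θ
      = a * Real.cos (3 * θ) + b * Real.sin (3 * θ)) ∧
    (∀ θ θ' : ℝ,
      (K (Real.cos θ, Real.sin θ) (Real.cos θ, Real.sin θ)).1 * Real.cos θ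
        + (K (Real.cos θ, Real.sin θ) (Real.cos θ, Real.sin θ)).2 * Real.sin θ = 0 →
      (K (Real.cos θ', Real.sin θ') (Real.cos θ', Real.sin θ')).1 * Real.cos θ'
        + (K (Real.cos θ', Real.sin θ') (Real.cos θ', Real.sin θ')).2 * Real.sin θ' = 0 →
      ∃ k : ℤ, θ - θ' = k * (Real.pi / 3)) := by
  have cubic : ∀ θ : ℝ,
      (K (Real.cos θ, Real.sin θ) (Real.cos θ, Real.sin θ)).1 * Real.cos θ
        + (K (Real.cos θ, Real.sin θ) (Real.cos θ, Real.sin θ)).2 * Real.sin θ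
      = a * Real.cos (3 * θ) + b * Real.sin (3 * θ) := by
    intro θ
    have hv : ((Real.cos θ, Real.sin θ) : ℝ × ℝ)
        = Real.cos θ • ((1 : ℝ), (0 : ℝ)) + Real.sin θ • ((0 : ℝ), (1 : ℝ)) := by
      simp
    have h21 : K (0, 1) (1, 0) = (b, -a) := by rw [hsymm, h12]
    rw [hv]
    simp only [map_add, map_smul, LinearMap.add_apply, LinearMap.smul_apply, h11, h12, h21, h22,
      Prod.fst_add, Prod.snd_add, Prod.smul_fst, Prod.smul_snd, smul_eq_mul,
      Real.cos_three_mul, Real.sin_three_mul]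
    linear_combination (3 * b * Real.sin θ - 3 * a * Real.cos θ) * Real.sin_sq_add_cos_sq θ
  refine ⟨cubic, fun θ θ' h h' => ?_⟩
  rw [cubic] at h h'
  obtain ⟨k, hk⟩ := Real.sin_eq_zero_iff.mp (sin_sub_eq_zero_of_cos_sin_comb hab h h')
  exact ⟨k, by linear_combination -hk / 3⟩
end

section
/- Let a, b ∈ ℝ and let K : ℝ² × ℝ² → ℝ² be the symmetric bilinear map determined by K(e₁,e₁) = a e₁ + b e₂, K(e₁,e₂) = K(e₂,e₁) = b e₁ − a e₂, K(e₂,e₂) = −a e₁ − b e₂, where (e₁, e₂) is the standard basis of ℝ². Then for all U, V, W ∈ ℝ²: K(U, K(V, W)) − K(V, K(U, W)) = −2(a² + b²)·(⟨V, W⟩U − ⟨U, W⟩V), where ⟨·,·⟩ is the standard inner product on ℝ². -/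
/-- identity (3.3) of Lemma A. For the symmetric bilinear map `K`
on `ℝ²` in the `(a,b)`-form (definite case), the commutator identity
`[K_U, K_V]W = −2(a² + b²)(⟨V,W⟩U − ⟨U,W⟩V)` holds, where `⟨·,·⟩` is the
standard inner product. -/
theorem stmt13 (a b : ℝ)
    (K : (ℝ × ℝ) →ₗ[ℝ] (ℝ × ℝ) →ₗ[ℝ] (ℝ × ℝ))
    (hsymm : ∀ x y : ℝ × ℝ, K x y = K y x)
    (h11 : K (1, 0) (1, 0) = (a, b))
    (h12 : K (1, 0) (0, 1) = (b, -a))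
    (h22 : K (0, 1) (0, 1) = (-a, -b)) :
    ∀ U V W : ℝ × ℝ,
      K U (K V W) - K V (K U W)
        = (-2 * (a ^ 2 + b ^ 2)) •
            ((V.1 * W.1 + V.2 * W.2) • U - (U.1 * W.1 + U.2 * W.2) • V) := by
  have h21 : K (0, 1) (1, 0) = (b, -a) := (hsymm _ _).trans h12
  have hK : ∀ x y : ℝ × ℝ, K x y =
      (a * (x.1 * y.1 - x.2 * y.2) + b * (x.1 * y.2 + x.2 * y.1),
        b * (x.1 * y.1 - x.2 * y.2) - a * (x.1 * y.2 + x.2 * y.1)) := by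
    have decomp : ∀ x : ℝ × ℝ, x = x.1 • (1, 0) + x.2 • (0, 1) := fun x => by
      ext <;> simp
    intro x y
    conv_lhs => rw [decomp x, decomp y]
    simp only [map_add, map_smul, LinearMap.add_apply, LinearMap.smul_apply, h11, h12, h21, h22]
    ext <;> simp <;> ring
  intro U V W
  simp only [hK]
  ext <;> simp <;> ring
end

section
/- Let a, b ∈ ℝ, let h be the symmetric bilinear form on ℝ² given by h(x, y) = x₁y₁ − x₂y₂, and let K : ℝ² × ℝ² → ℝ² be the symmetric bilinear map determined by K(e₁,e₁) = a e₁ + b e₂, K(e₁,e₂) = K(e₂,e₁) = −(b e₁ + a e₂), K(e₂,e₂) = a e₁ + b e₂, where (e₁, e₂) is the standard basis of ℝ². Then for all U, V, W ∈ ℝ²: K(U, K(V, W)) − K(V, K(U, W)) = −2(a² − b²)·(h(V, W)U − h(U, W)V). -/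
/-- the indefinite-metric case of the Corollary in Section 4.
For the symmetric bilinear map `K` on `ℝ²` in the indefinite `(a,b)`-form and
`h(x,y) = x₁y₁ − x₂y₂`, the commutator identity
`[K_U, K_V]W = −2(a² − b²)(h(V,W)U − h(U,W)V)` holds. -/
theorem stmt14 (a b : ℝ)
    (K : (ℝ × ℝ) →ₗ[ℝ] (ℝ × ℝ) →ₗ[ℝ] (ℝ × ℝ))
    (hsymm : ∀ x y : ℝ × ℝ, K x y = K y x)
    (h11 : K (1, 0) (1, 0) = (a, b))
    (h12 : K (1, 0) (0, 1) = (-b, -a))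
    (h22 : K (0, 1) (0, 1) = (a, b)) :
    ∀ U V W : ℝ × ℝ,
      K U (K V W) - K V (K U W)
        = (-2 * (a ^ 2 - b ^ 2)) •
            ((V.1 * W.1 - V.2 * W.2) • U - (U.1 * W.1 - U.2 * W.2) • V) := by
  have expand : ∀ x y : ℝ × ℝ, K x y =
      (a * (x.1 * y.1 + x.2 * y.2) - b * (x.1 * y.2 + x.2 * y.1),
        b * (x.1 * y.1 + x.2 * y.2) - a * (x.1 * y.2 + x.2 * y.1)) := by
    intro x y
    have decomp : ∀ z : ℝ × ℝ, z = z.1 • ((1, 0) : ℝ × ℝ) + z.2 • ((0, 1) : ℝ × ℝ) := by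
      intro z
      ext <;> simp
    have h21 : K (0, 1) (1, 0) = (-b, -a) := by rw [hsymm, h12]
    conv_lhs => rw [decomp x, decomp y]
    simp only [map_add, map_smul, LinearMap.add_apply, LinearMap.smul_apply, h11, h12, h21, h22]
    ext <;> simp <;> ring
  intro U V W
  simp only [expand]
  ext <;> simp <;> ring
end

section
/- Let a, b ∈ ℝ with a > 0 and a² − b² > 0, and set λ := √(a² − b²). Let K : ℝ² × ℝ² → ℝ² be the symmetric bilinear map determined by K(e₁,e₁) = a e₁ + b e₂, K(e₁,e₂) = K(e₂,e₁) = −(b e₁ + a e₂), K(e₂,e₂) = a e₁ + b e₂, where (e₁, e₂) is the standard basis of ℝ². Then there exists φ ∈ ℝ such that the vectors X := cosh(φ) e₁ + sinh(φ) e₂ and Y := sinh(φ) e₁ + cosh(φ) e₂ satisfy K(X,X) = λX, K(X,Y) = K(Y,X) = −λY, and K(Y,Y) = λX. -/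
/-- Every point of the right branch of the hyperbola `a ^ 2 - b ^ 2 = r ^ 2` is
`(r * cosh t, r * sinh t)` for some `t`. -/
theorem exists_eq_mul_cosh_and_eq_mul_sinh {a b r : ℝ} (ha : 0 < a) (hr : 0 < r)
    (h : a ^ 2 - b ^ 2 = r ^ 2) :
    ∃ t : ℝ, a = r * Real.cosh t ∧ b = r * Real.sinh t := by
  refine ⟨Real.arsinh (b / r), ?_, ?_⟩
  · have hsq : 1 + (b / r) ^ 2 = (a / r) ^ 2 := by
      field_simp
      linarith
    rw [Real.cosh_arsinh, hsq, Real.sqrt_sq (by positivity)]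
    field_simp
  · rw [Real.sinh_arsinh]
    field_simp

/-- A bilinear map on `ℝ × ℝ` in the indefinite `(a, b)`-form, written in coordinates. -/
theorem bilin_apply_of_basis {a b : ℝ} {K : (ℝ × ℝ) →ₗ[ℝ] (ℝ × ℝ) →ₗ[ℝ] (ℝ × ℝ)}
    (h11 : K (1, 0) (1, 0) = (a, b)) (h12 : K (1, 0) (0, 1) = (-b, -a))
    (h21 : K (0, 1) (1, 0) = (-b, -a)) (h22 : K (0, 1) (0, 1) = (a, b)) (x y u v : ℝ) :
    K (x, y) (u, v) =
      ((x * u + y * v) * a - (x * v + y * u) * b,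
        (x * u + y * v) * b - (x * v + y * u) * a) := by
  have decomp (p q : ℝ) : ((p, q) : ℝ × ℝ) = p • (1, 0) + q • (0, 1) := by simp
  rw [decomp x y, decomp u v]
  simp only [map_add, map_smul, LinearMap.add_apply, LinearMap.smul_apply, h11, h12, h21, h22]
  ext <;> simp <;> ring

/-- pointwise content of case (4.3) of Lemma A1. For the symmetric
bilinear map `K` on `ℝ²` in the indefinite `(a,b)`-form with `a > 0`,
`a² − b² > 0` and `λ = √(a² − b²)`, there is a hyperbolically rotated frame
`X = cosh φ e₁ + sinh φ e₂`, `Y = sinh φ e₁ + cosh φ e₂` in which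
`K(X,X) = λX`, `K(X,Y) = −λY`, `K(Y,Y) = λX`. -/
theorem stmt15 (a b : ℝ) (ha : 0 < a) (hab : 0 < a ^ 2 - b ^ 2)
    (lam : ℝ) (hlam : lam = Real.sqrt (a ^ 2 - b ^ 2))
    (K : (ℝ × ℝ) →ₗ[ℝ] (ℝ × ℝ) →ₗ[ℝ] (ℝ × ℝ))
    (hsymm : ∀ x y : ℝ × ℝ, K x y = K y x)
    (h11 : K (1, 0) (1, 0) = (a, b))
    (h12 : K (1, 0) (0, 1) = (-b, -a))
    (h22 : K (0, 1) (0, 1) = (a, b)) :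
    ∃ φ : ℝ,
      K (Real.cosh φ, Real.sinh φ) (Real.cosh φ, Real.sinh φ)
          = lam • (Real.cosh φ, Real.sinh φ) ∧
      K (Real.cosh φ, Real.sinh φ) (Real.sinh φ, Real.cosh φ)
          = (-lam) • (Real.sinh φ, Real.cosh φ) ∧
      K (Real.sinh φ, Real.cosh φ) (Real.cosh φ, Real.sinh φ)
          = (-lam) • (Real.sinh φ, Real.cosh φ) ∧
      K (Real.sinh φ, Real.cosh φ) (Real.sinh φ, Real.cosh φ)
          = lam • (Real.cosh φ, Real.sinh φ) := by
  have hpos : 0 < lam := hlam ▸ Real.sqrt_pos.2 hab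
  have hsq : a ^ 2 - b ^ 2 = lam ^ 2 := by rw [hlam, Real.sq_sqrt hab.le]
  obtain ⟨t, hat, hbt⟩ := exists_eq_mul_cosh_and_eq_mul_sinh ha hpos hsq
  have ht : t = 3 * (t / 3) := by ring
  rw [ht, Real.cosh_three_mul] at hat
  rw [ht, Real.sinh_three_mul] at hbt
  have hK := bilin_apply_of_basis h11 h12 ((hsymm _ _).trans h12) h22
  refine ⟨t / 3, ?_⟩
  have hcs := Real.cosh_sq (t / 3)
  generalize Real.cosh (t / 3) = c at *
  generalize Real.sinh (t / 3) = s at *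
  simp only [hK, Prod.smul_mk, smul_eq_mul, Prod.mk.injEq]
  subst hat hbt
  refine ⟨⟨?_, ?_⟩, ⟨?_, ?_⟩, ⟨?_, ?_⟩, ?_, ?_⟩ <;> clear * - hcs <;> grind
end

section
/- Let a, b ∈ ℝ with b > 0 and b² − a² > 0, and set λ := √(b² − a²). Let K : ℝ² × ℝ² → ℝ² be the symmetric bilinear map determined by K(e₁,e₁) = a e₁ + b e₂, K(e₁,e₂) = K(e₂,e₁) = −(b e₁ + a e₂), K(e₂,e₂) = a e₁ + b e₂, where (e₁, e₂) is the standard basis of ℝ². Then there exists φ ∈ ℝ such that the vectors X := cosh(φ) e₁ + sinh(φ) e₂ and Y := sinh(φ) e₁ + cosh(φ) e₂ satisfy K(X,X) = λY, K(X,Y) = K(Y,X) = −λX, and K(Y,Y) = λY. -/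
/-- The value at arbitrary vectors of a symmetric bilinear map on `ℝ²` in the indefinite
`(a, b)`-form. -/
lemma bilin_apply_of_indefinite_form {a b : ℝ}
    {K : (ℝ × ℝ) →ₗ[ℝ] (ℝ × ℝ) →ₗ[ℝ] (ℝ × ℝ)}
    (hsymm : ∀ x y : ℝ × ℝ, K x y = K y x)
    (h11 : K (1, 0) (1, 0) = (a, b))
    (h12 : K (1, 0) (0, 1) = (-b, -a))
    (h22 : K (0, 1) (0, 1) = (a, b)) (p q r s : ℝ) :
    K (p, q) (r, s) =
      (a * (p * r + q * s) - b * (p * s + q * r),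
        b * (p * r + q * s) - a * (p * s + q * r)) := by
  have h21 : K (0, 1) (1, 0) = (-b, -a) := (hsymm _ _).trans h12
  have decomp (u v : ℝ) : ((u, v) : ℝ × ℝ) = u • (1, 0) + v • (0, 1) := by simp
  rw [decomp p q, decomp r s]
  simp only [map_add, map_smul, LinearMap.add_apply, LinearMap.smul_apply, h11, h12, h21, h22]
  ext <;> simp <;> ring

/-- A point of the cone `|a| < b` has hyperbolic polar coordinates. -/
lemma exists_hyperbolic_polar {a b : ℝ} (hb : 0 < b) (hab : 0 < b ^ 2 - a ^ 2) :
    ∃ t : ℝ, a = √(b ^ 2 - a ^ 2) * Real.sinh t ∧ b = √(b ^ 2 - a ^ 2) * Real.cosh t := by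
  have hpos : 0 < √(b ^ 2 - a ^ 2) := Real.sqrt_pos.mpr hab
  have hsq : √(b ^ 2 - a ^ 2) ^ 2 = b ^ 2 - a ^ 2 := Real.sq_sqrt hab.le
  set l := √(b ^ 2 - a ^ 2)
  have ha : a = l * Real.sinh (Real.arsinh (a / l)) := by
    rw [Real.sinh_arsinh]
    field_simp
  refine ⟨Real.arsinh (a / l), ha, ?_⟩
  set t := Real.arsinh (a / l)
  rw [← sq_eq_sq₀ hb.le (mul_pos hpos (Real.cosh_pos t)).le, mul_pow, Real.cosh_sq]
  linear_combination (a + l * Real.sinh t) * ha - hsq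

/-- pointwise content of case (ii) of Lemma A1. For the symmetric
bilinear map `K` on `ℝ²` in the indefinite `(a,b)`-form with `b > 0`,
`b² − a² > 0` and `λ = √(b² − a²)`, there is a hyperbolically rotated frame
`X = cosh φ e₁ + sinh φ e₂`, `Y = sinh φ e₁ + cosh φ e₂` in which
`K(X,X) = λY`, `K(X,Y) = −λX`, `K(Y,Y) = λY`. -/
theorem stmt16 (a b : ℝ) (hb : 0 < b) (hab : 0 < b ^ 2 - a ^ 2)
    (lam : ℝ) (hlam : lam = Real.sqrt (b ^ 2 - a ^ 2))
    (K : (ℝ × ℝ) →ₗ[ℝ] (ℝ × ℝ) →ₗ[ℝ] (ℝ × ℝ))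
    (hsymm : ∀ x y : ℝ × ℝ, K x y = K y x)
    (h11 : K (1, 0) (1, 0) = (a, b))
    (h12 : K (1, 0) (0, 1) = (-b, -a))
    (h22 : K (0, 1) (0, 1) = (a, b)) :
    ∃ φ : ℝ,
      K (Real.cosh φ, Real.sinh φ) (Real.cosh φ, Real.sinh φ)
          = lam • (Real.sinh φ, Real.cosh φ) ∧
      K (Real.cosh φ, Real.sinh φ) (Real.sinh φ, Real.cosh φ)
          = (-lam) • (Real.cosh φ, Real.sinh φ) ∧
      K (Real.sinh φ, Real.cosh φ) (Real.cosh φ, Real.sinh φ)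
          = (-lam) • (Real.cosh φ, Real.sinh φ) ∧
      K (Real.sinh φ, Real.cosh φ) (Real.sinh φ, Real.cosh φ)
          = lam • (Real.sinh φ, Real.cosh φ) := by
  obtain ⟨t, ha, hb'⟩ := exists_hyperbolic_polar hb hab
  rw [← hlam] at ha hb'
  have ht : t = 2 * (t / 3) + t / 3 := by ring
  rw [ht, Real.sinh_add, Real.sinh_two_mul, Real.cosh_two_mul] at ha
  rw [ht, Real.cosh_add, Real.sinh_two_mul, Real.cosh_two_mul] at hb'
  have hcs := Real.cosh_sq_sub_sinh_sq (t / 3)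
  refine ⟨t / 3, ?_⟩
  simp only [bilin_apply_of_indefinite_form hsymm h11 h12 h22, Prod.smul_mk, smul_eq_mul,
    Prod.mk.injEq]
  set c := Real.cosh (t / 3)
  set s := Real.sinh (t / 3)
  have hs : a * (c ^ 2 + s ^ 2) - b * (2 * s * c) = lam * s := by
    rw [ha, hb']
    linear_combination lam * s * (c ^ 2 - s ^ 2 + 1) * hcs
  have hc : b * (c ^ 2 + s ^ 2) - a * (2 * s * c) = lam * c := by
    rw [ha, hb']
    linear_combination lam * c * (c ^ 2 - s ^ 2 + 1) * hcs
  refine ⟨⟨?_, ?_⟩, ⟨?_, ?_⟩, ⟨?_, ?_⟩, ?_, ?_⟩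
  · linear_combination hs
  · linear_combination hc
  · linear_combination -hc
  · linear_combination -hs
  · linear_combination -hc
  · linear_combination -hs
  · linear_combination hs
  · linear_combination hc
end
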